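/- Let g be a finite-dimensional real Lie algebra with radical r such that ⁅g, r⁆ = r, ⁅r, r⁆ = {0}, and the centre of g is trivial. Let a be an abelian Lie subalgebra of g such that ad(H) is a semisimple linear endomorphism of g for every H ∈ a. Then there exists a Levi subalgebra l of g with a ⊆ l. -/

import Mathlib

/-- `l` is a Levi subalgebra of `g`: a semisimple Lie subalgebra that is a vector-space
complement of the radical of `g`. -/
def IsLeviSubalgebra (g : Type*) [LieRing g] [LieAlgebra ℝ g]
    (l : LieSubalgebra ℝ g) : Prop :=
  LieAlgebra.IsSemisimple ℝ l ∧
    IsCompl l.toSubmodule (LieAlgebra.radical ℝ g).toSubmodule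

section

open LieAlgebra LieModule Module
open scoped TensorProduct

section Whitehead

variable {K L : Type*} [Field K] [LieRing L] [LieAlgebra K L]

variable {M : Type*} [AddCommGroup M] [Module K M] [LieRingModule L M] [LieModule K L M]

variable (K M) in
/-- The endomorphism `∑ i, b i * b' i` of a Lie module attached to two finite families of elements
of the Lie algebra. -/
noncomputable def LieModule.casimir {ι : Type*} [Fintype ι] (b b' : ι → L) : End K M :=
  ∑ i, toEnd K L M (b i) * toEnd K L M (b' i)

lemma LieModule.casimir_apply {ι : Type*} [Fintype ι] (b b' : ι → L) (m : M) :
    casimir K M b b' m = ∑ i, ⁅b i, ⁅b' i, m⁆⁆ := by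
  simp [casimir]

lemma LieModule.coe_casimir_apply {ι : Type*} [Fintype ι] (b b' : ι → L) (N : LieSubmodule K L M)
    (n : N) : (casimir K N b b' n : M) = casimir K M b b' n := by
  simp [casimir_apply]

lemma LieModule.casimir_lie {ι : Type*} [Fintype ι] {b b' : ι → L}
    (h : ∀ x : L, ∑ i, (⁅x, b i⁆ ⊗ₜ[K] b' i + b i ⊗ₜ[K] ⁅x, b' i⁆) = 0) (x : L) (m : M) :
    casimir K M b b' ⁅x, m⁆ = ⁅x, casimir K M b b' m⁆ := by
  have h' := congrArg (LinearMap.applyₗ m ∘ₗ (LinearMap.mul' K (End K M)) ∘ₗ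
    TensorProduct.map (toEnd K L M : L →ₗ[K] End K M) (toEnd K L M : L →ₗ[K] End K M)) (h x)
  simp only [map_sum, map_add, LinearMap.comp_apply, TensorProduct.map_tmul, LinearMap.mul'_apply,
    map_zero, LinearMap.applyₗ_apply_apply, LieHom.coe_toLinearMap, Module.End.mul_apply,
    toEnd_apply_apply] at h'
  rw [casimir_apply, casimir_apply, lie_sum, eq_comm, ← sub_eq_zero, ← Finset.sum_sub_distrib,
    ← h']
  refine Finset.sum_congr rfl fun i _ ↦ ?_
  rw [leibniz_lie x (b i), leibniz_lie x (b' i), lie_add]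
  abel

variable [FiniteDimensional K L]

lemma LieIdeal.lie_self_eq_of_isKilling [IsKilling K L] (I : LieIdeal K L) : ⁅I, I⁆ = I := by
  have hD := LieIdeal.isCompl_killingCompl (⁅I, I⁆ : LieIdeal K L)
  have hDI : ⁅I, I⁆ ≤ I := LieSubmodule.lie_le_right I I
  have hab : IsLieAbelian (I ⊓ (⁅I, I⁆ : LieIdeal K L).killingCompl : LieIdeal K L) := by
    rw [LieSubmodule.lie_abelian_iff_lie_self_eq_bot, ← le_bot_iff, ← hD.inf_eq_bot]
    exact le_inf (LieSubmodule.mono_lie inf_le_left inf_le_left)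
      ((LieSubmodule.lie_le_right _ _).trans inf_le_right)
  have hbot := IsKilling.ideal_eq_bot_of_isLieAbelian
    (I ⊓ (⁅I, I⁆ : LieIdeal K L).killingCompl : LieIdeal K L)
  refine le_antisymm hDI fun x hx ↦ ?_
  obtain ⟨y, hy, z, hz, rfl⟩ := (LieSubmodule.mem_sup _ _ _).mp
    (hD.sup_eq_top ▸ LieSubmodule.mem_top x : x ∈ ⁅I, I⁆ ⊔ (⁅I, I⁆ : LieIdeal K L).killingCompl)
  have hzI : z ∈ I := by simpa using sub_mem hx (hDI hy)
  have : z ∈ (⊥ : LieIdeal K L) := hbot ▸ ⟨hzI, hz⟩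
  rw [(LieSubmodule.mem_bot z).mp this, add_zero]
  exact hy

lemma LieIdeal.induction_of_isKilling [IsKilling K L] (I : LieIdeal K L) {p : L → Prop}
    (lie : ∀ x ∈ I, ∀ y ∈ I, p ⁅x, y⁆) (add : ∀ x y, p x → p y → p (x + y)) (zero : p 0)
    (smul : ∀ (t : K) x, p x → p (t • x)) {x : L} (hx : x ∈ I) : p x := by
  rw [← I.lie_self_eq_of_isKilling, ← LieSubmodule.mem_toSubmodule,
    LieSubmodule.lieIdeal_oper_eq_linear_span'] at hx
  induction hx using Submodule.span_induction with
  | mem x h => obtain ⟨y, hy, z, hz, rfl⟩ := h; exact lie y hy z hz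
  | zero => exact zero
  | add x y _ _ hx hy => exact add x y hx hy
  | smul t x _ hx => exact smul t x hx

lemma LieModule.lie_eq_zero_of_isIrreducible_of_traceForm_eq_zero [CharZero K] [IsKilling K L]
    [FiniteDimensional K M] [IsIrreducible K L M] (I : LieIdeal K L)
    (hI : ∀ x ∈ I, ∀ y ∈ I, traceForm K L M x y = 0) {x : L} (hx : x ∈ I) (m : M) :
    ⁅x, m⁆ = 0 := by
  have : Nontrivial M := nontrivial_of_isIrreducible K L M
  have htr : traceForm K I M = 0 := by
    ext x y
    exact hI x x.2 y y.2
  have hnil := isNilpotent_derivedSeries_of_traceForm_eq_zero htr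
  let Z : LieSubmodule K L M :=
    { carrier := {m | ∀ x ∈ I, ⁅x, m⁆ = 0}
      add_mem' := fun ha hb x hx ↦ by rw [lie_add, ha x hx, hb x hx, add_zero]
      zero_mem' := fun x _ ↦ lie_zero x
      smul_mem' := fun t m hm x hx ↦ by rw [lie_smul, hm x hx, smul_zero]
      lie_mem := fun {y m} hm x hx ↦ by
        rw [leibniz_lie, hm x hx, lie_zero, add_zero]
        exact hm _ (lie_mem_left K L I x y hx) }
  have := nontrivial_max_triv_of_isNilpotent K (derivedSeries K I 1) M
  obtain ⟨⟨m₀, hm₀⟩, hne⟩ :=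
    exists_ne (0 : maxTrivSubmodule K (derivedSeries K I 1) M)
  have hm₀Z : m₀ ∈ Z := by
    intro x hx
    have hx' : (⟨x, hx⟩ : I) ∈ derivedSeries K I 1 := by
      rw [LieIdeal.derivedSeries_eq_derivedSeriesOfIdeal_comap, LieIdeal.mem_comap,
        derivedSeriesOfIdeal_succ, derivedSeriesOfIdeal_zero, I.lie_self_eq_of_isKilling]
      exact hx
    exact (mem_maxTrivSubmodule K _ M m₀).mp hm₀ ⟨_, hx'⟩
  have : Nontrivial Z := ⟨⟨m₀, hm₀Z⟩, 0, fun h ↦ hne (by simpa [Subtype.ext_iff] using h)⟩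
  have hZ : m ∈ Z := Z.eq_top_of_isIrreducible K L M ▸ LieSubmodule.mem_top m
  exact hZ x hx

lemma LieIdeal.exists_dual_families (J : LieIdeal K L) (B : LinearMap.BilinForm K L)
    (hs : B.IsSymm) (hB : ∀ x y z : L, B ⁅x, y⁆ z = - B y ⁅x, z⁆)
    (hnd : ∀ x ∈ J, (∀ y ∈ J, B x y = 0) → x = 0) :
    ∃ b b' : Fin (finrank K J) → L, (∀ i, b i ∈ J) ∧ (∀ i, b' i ∈ J) ∧ (∀ i, B (b i) (b' i) = 1) ∧
      ∀ x : L, ∑ i, (⁅x, b i⁆ ⊗ₜ[K] b' i + b i ⊗ₜ[K] ⁅x, b' i⁆) = 0 := by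
  let BJ : LinearMap.BilinForm K J := B.restrict J.toSubmodule
  have hsJ : BJ.IsSymm := ⟨fun x y ↦ hs.eq x y⟩
  have hBJ : BJ.Nondegenerate := by
    refine hsJ.isRefl.nondegenerate_iff_separatingLeft.mpr fun x hx ↦ ?_
    exact Subtype.ext (hnd x x.2 fun y hy ↦ hx ⟨y, hy⟩)
  let b := finBasis K J
  let b' := BJ.dualBasis hBJ b
  have h1 (x : L) (i) : ⁅x, (b i : L)⁆ = ∑ j, B ⁅x, (b i : L)⁆ (b' j) • (b j : L) := by
    have h := (BJ.dualBasis hBJ b').sum_repr ⟨_, J.lie_mem (b i).2 (x := x)⟩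
    simp only [LinearMap.BilinForm.dualBasis_repr_apply] at h
    rw [LinearMap.BilinForm.dualBasis_dualBasis hBJ hsJ b] at h
    exact (congrArg Subtype.val h).symm.trans (by simp; rfl)
  have h2 (x : L) (i) : ⁅x, (b' i : L)⁆ = ∑ j, B ⁅x, (b' i : L)⁆ (b j) • (b' j : L) := by
    have h := b'.sum_repr ⟨_, J.lie_mem (b' i).2 (x := x)⟩
    simp only [b', LinearMap.BilinForm.dualBasis_repr_apply] at h
    exact (congrArg Subtype.val h).symm.trans (by simp; rfl)
  refine ⟨fun i ↦ b i, fun i ↦ b' i, fun i ↦ (b i).2, fun i ↦ (b' i).2, fun i ↦ ?_, fun x ↦ ?_⟩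
  · exact (LinearMap.BilinForm.apply_dualBasis_right hBJ hsJ b i i).trans (if_pos rfl)
  · have h3 : ∑ i, ⁅x, (b i : L)⁆ ⊗ₜ[K] (b' i : L) =
        ∑ i, ∑ j, B ⁅x, (b i : L)⁆ (b' j) • ((b j : L) ⊗ₜ[K] (b' i : L)) := by
      refine Finset.sum_congr rfl fun i _ ↦ ?_
      conv_lhs => rw [h1]
      simp only [TensorProduct.sum_tmul, TensorProduct.smul_tmul']
    have h4 : ∑ i, (b i : L) ⊗ₜ[K] ⁅x, (b' i : L)⁆ =
        ∑ i, ∑ j, B ⁅x, (b' i : L)⁆ (b j) • ((b i : L) ⊗ₜ[K] (b' j : L)) := by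
      refine Finset.sum_congr rfl fun i _ ↦ ?_
      conv_lhs => rw [h2]
      simp only [TensorProduct.tmul_sum, TensorProduct.tmul_smul]
    rw [Finset.sum_add_distrib, h3, h4, Finset.sum_comm, ← Finset.sum_add_distrib]
    refine Finset.sum_eq_zero fun i _ ↦ ?_
    rw [← Finset.sum_add_distrib]
    refine Finset.sum_eq_zero fun j _ ↦ ?_
    rw [← add_smul, hB, hs.eq, neg_add_cancel, zero_smul]

lemma LieModule.exists_mem_forall_lie_sub_eq_zero_of_isIrreducible [CharZero K] [IsKilling K L]
    (N : LieSubmodule K L M) [FiniteDimensional K N] [IsIrreducible K L N] (m : M)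
    (hm : ∀ x : L, ⁅x, m⁆ ∈ N) : ∃ n ∈ N, ∀ x : L, ⁅x, m - n⁆ = 0 := by
  let R : LieIdeal K L :=
    { LinearMap.ker (traceForm K L N) with
      lie_mem := fun {x y} hy ↦ by
        refine LinearMap.ext fun z ↦ ?_
        replace hy : traceForm K L N y = 0 := hy
        rw [← lie_skew, map_neg, LinearMap.neg_apply, traceForm_apply_lie_apply, hy]
        simp }
  have hR (x : L) : x ∈ R ↔ traceForm K L N x = 0 := Iff.rfl
  have hRN (x : L) (hx : x ∈ R) (n : N) : ⁅x, n⁆ = 0 :=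
    lie_eq_zero_of_isIrreducible_of_traceForm_eq_zero R
      (fun x hx y _ ↦ by rw [(hR x).mp hx, LinearMap.zero_apply]) hx n
  have hc := R.isCompl_killingCompl
  by_cases hJ : R.killingCompl = ⊥
  · have hRtop : R = ⊤ := by simpa [hJ] using hc.sup_eq_top
    refine ⟨0, N.zero_mem, fun x ↦ ?_⟩
    rw [sub_zero]
    refine R.induction_of_isKilling (p := fun x ↦ ⁅x, m⁆ = 0) (fun x hx y hy ↦ ?_)
      (fun x y hx hy ↦ ?_) (zero_lie m) (fun t x hx ↦ ?_) (hRtop ▸ LieSubmodule.mem_top x)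
    · have h1 := congrArg Subtype.val (hRN x hx ⟨_, hm y⟩)
      have h2 := congrArg Subtype.val (hRN y hy ⟨_, hm x⟩)
      simp only [LieSubmodule.coe_bracket, LieSubmodule.coe_zero] at h1 h2
      rw [lie_lie, h1, h2, sub_zero]
    · rw [add_lie, hx, hy, add_zero]
    · rw [smul_lie, hx, smul_zero]
  · obtain ⟨b, b', -, -, hb, h⟩ := R.killingCompl.exists_dual_families (traceForm K L N)
      ⟨traceForm_comm K L N⟩
      (fun x y z ↦ by rw [← lie_skew x y, map_neg, LinearMap.neg_apply, traceForm_apply_lie_apply])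
      (fun x hx hxy ↦ by
        have hxR : x ∈ R := LinearMap.ext fun y ↦ by
          obtain ⟨u, hu, v, hv, rfl⟩ := (LieSubmodule.mem_sup _ _ _).mp
            (hc.sup_eq_top ▸ LieSubmodule.mem_top y : y ∈ R ⊔ R.killingCompl)
          rw [map_add, hxy v hv, traceForm_comm, (hR u).mp hu]
          simp
        have hmem : x ∈ R ⊓ R.killingCompl := ⟨hxR, hx⟩
        simpa [hc.inf_eq_bot] using hmem)
    have htr : casimir K N b b' ≠ 0 := by
      intro h0
      have h1 := congrArg (LinearMap.trace K N) h0
      have h2 : LinearMap.trace K N (casimir K N b b') = finrank K R.killingCompl := by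
        simp only [casimir, map_sum]
        calc _ = ∑ i, traceForm K L N (b i) (b' i) := rfl
          _ = _ := by simp [hb]
      rw [h2, map_zero, Nat.cast_eq_zero] at h1
      have h3 : R.killingCompl.toSubmodule = ⊥ := Submodule.finrank_eq_zero.mp h1
      exact hJ ((LieSubmodule.toSubmodule_eq_bot _).mp h3)
    let Z : LieSubmodule K L N :=
      { LinearMap.ker (casimir K N b b') with
        lie_mem := fun {x y} hy ↦ by
          change casimir K N b b' ⁅x, y⁆ = 0
          rw [casimir_lie h, show casimir K N b b' y = 0 from hy, lie_zero] }
    have hZ : Z = ⊥ := (eq_bot_or_eq_top Z).resolve_right fun hZ ↦ htr <| LinearMap.ext fun n ↦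
      show n ∈ Z from hZ ▸ LieSubmodule.mem_top n
    have hinj (n : N) (hn : casimir K N b b' n = 0) : n = 0 := by
      simpa using (hZ ▸ (show n ∈ Z from hn) : n ∈ (⊥ : LieSubmodule K L N))
    have hsurj : Function.Surjective (casimir K N b b') :=
      LinearMap.injective_iff_surjective.mp ((injective_iff_map_eq_zero _).mpr hinj)
    have hCm : casimir K M b b' m ∈ N := by
      rw [casimir_apply]
      exact sum_mem fun i _ ↦ N.lie_mem (hm _)
    obtain ⟨n, hn⟩ := hsurj ⟨_, hCm⟩
    refine ⟨n, n.2, fun x ↦ ?_⟩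
    have hx : ⁅x, m - n⁆ ∈ N := by
      rw [lie_sub]
      exact sub_mem (hm x) (N.lie_mem n.2)
    refine congrArg Subtype.val (hinj ⟨_, hx⟩ (Subtype.ext ?_))
    rw [coe_casimir_apply, casimir_lie h, map_sub, ← coe_casimir_apply, hn, sub_self, lie_zero]
    rfl

/-- Whitehead's first lemma: the obstruction to lifting invariants vanishes for Killing Lie
algebras. -/
theorem LieModule.exists_mem_forall_lie_sub_eq_zero [CharZero K] [IsKilling K L]
    [FiniteDimensional K M] (N : LieSubmodule K L M) (m : M) (hm : ∀ x : L, ⁅x, m⁆ ∈ N) :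
    ∃ n ∈ N, ∀ x : L, ⁅x, m - n⁆ = 0 := by
  induction hd : finrank K N using Nat.strong_induction_on generalizing M with
  | _ d ih =>
  obtain rfl | hN := eq_or_ne N ⊥
  · exact ⟨0, zero_mem _, by simpa using hm⟩
  by_cases h : ∃ N' : LieSubmodule K L M, N' ≠ ⊥ ∧ N' < N
  · obtain ⟨N', hN', hlt⟩ := h
    let π := LieSubmodule.Quotient.mk' N'
    obtain ⟨q, hq, hqm⟩ := ih (finrank K (N.map π)) (by
        rw [← hd]
        have hmap : finrank K (N.map π) =
            finrank K (LinearMap.range ((π : M →ₗ[K] M ⧸ N').domRestrict N.toSubmodule)) := by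
          rw [LinearMap.range_domRestrict]
          rfl
        have hker : LinearMap.ker ((π : M →ₗ[K] M ⧸ N').domRestrict N.toSubmodule) ≠ ⊥ := by
          obtain ⟨v, hv, hv0⟩ : ∃ v ∈ N', v ≠ 0 := by
            simpa [LieSubmodule.eq_bot_iff] using hN'
          refine (Submodule.ne_bot_iff _).mpr ⟨⟨v, hlt.le hv⟩, ?_, by simpa using hv0⟩
          exact (LieSubmodule.Quotient.mk_eq_zero N').mpr hv
        have hrn := LinearMap.finrank_range_add_finrank_ker
          ((π : M →ₗ[K] M ⧸ N').domRestrict N.toSubmodule)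
        have hpos := Submodule.one_le_finrank_iff.mpr hker
        have hN : finrank K N = finrank K N.toSubmodule := rfl
        omega) (N.map π) (π m) (fun x ↦ by
        rw [← LieModuleHom.map_lie]
        exact LieSubmodule.mem_map_of_mem (hm x)) rfl
    obtain ⟨n, hn, rfl⟩ := (LieSubmodule.mem_map _).mp hq
    obtain ⟨n', hn', hnm'⟩ := ih (finrank K N')
      (hd ▸ Submodule.finrank_lt_finrank_of_lt hlt) N' (m - n) (fun x ↦ by
        rw [← LieSubmodule.Quotient.mk_eq_zero, LieModuleHom.map_lie, map_sub]
        exact hqm x) rfl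
    exact ⟨n + n', add_mem hn (hlt.le hn'), fun x ↦ by rw [← sub_sub]; exact hnm' x⟩
  · have : Nontrivial N := (LieSubmodule.nontrivial_iff_ne_bot K L M).mpr hN
    have : IsIrreducible K L N := .mk fun Z hZ ↦ by
      have hle : Z.map N.incl ≤ N := by
        rintro - ⟨z, -, rfl⟩
        exact z.2
      have hne : Z.map N.incl ≠ ⊥ := by
        obtain ⟨v, hv, hv0⟩ : ∃ v ∈ Z, v ≠ 0 := by
          simpa [LieSubmodule.eq_bot_iff] using hZ
        intro hbot
        have hmem : N.incl v ∈ Z.map N.incl := LieSubmodule.mem_map_of_mem hv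
        exact hv0 (by simpa [hbot] using hmem)
      have heq : Z.map N.incl = N := by
        by_contra hcon
        exact h ⟨_, hne, lt_of_le_of_ne hle hcon⟩
      refine eq_top_iff.mpr fun v _ ↦ ?_
      have hv : (v : M) ∈ Z.map N.incl := by
        rw [heq]
        exact v.2
      obtain ⟨z, hz, hzv⟩ := (LieSubmodule.mem_map _).mp hv
      rwa [← Subtype.ext hzv]
    exact exists_mem_forall_lie_sub_eq_zero_of_isIrreducible N m hm

end Whitehead

/-- Whitehead's first lemma, for modules of a Lie algebra acting through a Killing quotient. -/
theorem LieModule.exists_mem_forall_lie_sub_eq_zero_of_surjective {K L S M : Type*} [Field K]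
    [CharZero K] [LieRing L] [LieAlgebra K L] [LieRing S] [LieAlgebra K S] [FiniteDimensional K S]
    [IsKilling K S] [AddCommGroup M] [Module K M] [LieRingModule L M] [LieModule K L M]
    [FiniteDimensional K M] (π : L →ₗ⁅K⁆ S) (hπ : Function.Surjective π)
    (hker : ∀ x ∈ π.ker, ∀ m : M, ⁅x, m⁆ = 0) (N : LieSubmodule K L M) (m : M)
    (hm : ∀ x : L, ⁅x, m⁆ ∈ N) : ∃ n ∈ N, ∀ x : L, ⁅x, m - n⁆ = 0 := by
  obtain ⟨σ, hσ⟩ := (π : L →ₗ[K] S).exists_rightInverse_of_surjective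
    (LinearMap.range_eq_top.mpr hπ)
  replace hσ (s : S) : π (σ s) = s := LinearMap.congr_fun hσ s
  have hlie (x y : L) (h : π x = π y) (v : M) : ⁅x, v⁆ = ⁅y, v⁆ := by
    rw [← sub_eq_zero, ← sub_lie]
    exact hker _ (by rw [LieHom.mem_ker, map_sub, h, sub_self]) v
  let _ : LieRingModule S M :=
    { bracket := fun s v ↦ ⁅σ s, v⁆
      add_lie := fun s t v ↦ by
        rw [map_add, add_lie]
      lie_add := fun s v w ↦ lie_add (σ s) v w
      leibniz_lie := fun s t v ↦ by
        change ⁅σ s, ⁅σ t, v⁆⁆ = ⁅σ ⁅s, t⁆, v⁆ + ⁅σ t, ⁅σ s, v⁆⁆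
        rw [leibniz_lie, hlie (σ ⁅s, t⁆) ⁅σ s, σ t⁆ (by rw [LieHom.map_lie, hσ, hσ, hσ])] }
  have hS (s : S) (v : M) : ⁅s, v⁆ = ⁅σ s, v⁆ := rfl
  let _ : LieModule K S M :=
    { smul_lie := fun t s v ↦ by rw [hS, hS, map_smul, smul_lie]
      lie_smul := fun t s v ↦ by rw [hS, hS, lie_smul] }
  obtain ⟨n, hn, h⟩ := exists_mem_forall_lie_sub_eq_zero (K := K) (L := S)
    { N.toSubmodule with lie_mem := fun {s v} hv ↦ N.lie_mem (x := σ s) hv } m (fun s ↦ hm (σ s))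
  exact ⟨n, hn, fun x ↦ (hlie x (σ (π x)) (hσ _).symm _).trans (h (π x))⟩

/-- The projection of a Lie algebra onto its quotient by an ideal. -/
def LieIdeal.mkHom {R L : Type*} [CommRing R] [LieRing L] [LieAlgebra R L] (I : LieIdeal R L) :
    L →ₗ⁅R⁆ L ⧸ I :=
  { (LieSubmodule.Quotient.mk' I : L →ₗ[R] L ⧸ I) with
    map_lie' := fun {x y} ↦ LieSubmodule.Quotient.mk_bracket I x y }

lemma LieIdeal.mkHom_surjective {R L : Type*} [CommRing R] [LieRing L] [LieAlgebra R L]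
    (I : LieIdeal R L) : Function.Surjective I.mkHom :=
  LieSubmodule.Quotient.surjective_mk' I

lemma LieIdeal.mkHom_eq_zero {R L : Type*} [CommRing R] [LieRing L] [LieAlgebra R L]
    {I : LieIdeal R L} {x : L} : I.mkHom x = 0 ↔ x ∈ I :=
  LieSubmodule.Quotient.mk_eq_zero I

instance LieAlgebra.hasTrivialRadical_quotient_radical {R L : Type*} [CommRing R] [LieRing L]
    [LieAlgebra R L] [IsNoetherian R L] : HasTrivialRadical R (L ⧸ radical R L) := by
  refine (hasTrivialRadical_iff_no_abelian_ideals R _).mpr fun J hJ ↦ ?_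
  let I : LieIdeal R L := J.comap (radical R L).mkHom
  have hI : ⁅I, I⁆ ≤ radical R L := by
    rw [LieSubmodule.lie_le_iff]
    intro x hx y hy
    rw [← LieIdeal.mkHom_eq_zero, LieHom.map_lie]
    exact congrArg Subtype.val (trivial_lie_zero J J ⟨_, hx⟩ ⟨_, hy⟩)
  have hsolv : IsSolvable I := by
    obtain ⟨k, hk⟩ := (isSolvable_iff R _).mp (inferInstance : IsSolvable (radical R L))
    refine IsSolvable.mk (R := R) (k := k + 1) ?_
    rw [LieIdeal.derivedSeries_eq_bot_iff] at hk ⊢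
    rw [derivedSeriesOfIdeal_add, derivedSeriesOfIdeal_succ, derivedSeriesOfIdeal_zero]
    exact le_bot_iff.mp (hk ▸ derivedSeriesOfIdeal_mono hI k)
  have hle : I ≤ radical R L := (LieIdeal.solvable_iff_le_radical R L I).mp hsolv
  refine (LieSubmodule.eq_bot_iff J).mpr fun y hy ↦ ?_
  obtain ⟨x, rfl⟩ := LieIdeal.mkHom_surjective _ y
  exact LieIdeal.mkHom_eq_zero.mpr (hle hy)

lemma Module.End.IsSemisimple.apply_eq_zero_of_apply_apply_eq_zero {K V : Type*} [Field K]
    [AddCommGroup V] [Module K V] [FiniteDimensional K V] {f : End K V} (hf : f.IsSemisimple) {v : V}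
    (h : f (f v) = 0) : f v = 0 := by
  have := IsFinitelySemisimple.genEigenspace_eq_eigenspace
    (isFinitelySemisimple_iff_isSemisimple.mpr hf) 0 (k := 2) (by norm_num)
  have hv : v ∈ f.eigenspace 0 := by
    rw [← this]
    exact (mem_genEigenspace_nat (k := 2)).mpr (by simpa [pow_two] using h)
  simpa using hv

lemma Module.End.exists_mem_forall_apply_sub_eq_zero {K V ι : Type*} [Field K] [AddCommGroup V]
    [Module K V] [FiniteDimensional K V] (T : ι → End K V) (hT : ∀ i, (T i).IsSemisimple)
    (hcomm : ∀ i j, Commute (T i) (T j)) (P : Submodule K V) (hP : ∀ i, ∀ p ∈ P, T i p ∈ P) {m : V}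
    (hm : ∀ i, T i m ∈ P) (s : Finset ι) : ∃ p ∈ P, ∀ i ∈ s, T i (m - p) = 0 := by
  classical
  induction s using Finset.induction_on with
  | empty => exact ⟨0, P.zero_mem, by simp⟩
  | insert i s _ ih =>
    obtain ⟨p, hp, h⟩ := ih
    have hc (i j) (v : V) : T i (T j v) = T j (T i v) := LinearMap.congr_fun (hcomm i j) v
    let Q : Submodule K V := P ⊓ ⨅ j ∈ s, LinearMap.ker (T j)
    have hQ (v : V) : v ∈ Q ↔ v ∈ P ∧ ∀ j ∈ s, T j v = 0 := by simp [Q]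
    have hTQ : ∀ v ∈ Q, T i v ∈ Q := fun v hv ↦ (hQ _).mpr ⟨hP i v ((hQ v).mp hv).1, fun j hj ↦ by
      rw [hc, ((hQ v).mp hv).2 j hj, map_zero]⟩
    have hu : T i (m - p) ∈ Q := (hQ _).mpr ⟨by
      rw [map_sub]
      exact sub_mem (hm i) (hP i p hp), fun j hj ↦ by rw [hc, h j hj, map_zero]⟩
    let f : End K Q := (T i).restrict hTQ
    have hker : LinearMap.ker (f * f) = LinearMap.ker f := by
      refine le_antisymm (fun v hv ↦ Subtype.ext ?_) fun v hv ↦ ?_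
      · exact (hT i).apply_eq_zero_of_apply_apply_eq_zero (congrArg Subtype.val hv)
      · change f (f v) = 0
        rw [show f v = 0 from hv, map_zero]
    have hrange : LinearMap.range (f * f) = LinearMap.range f := by
      refine Submodule.eq_of_le_of_finrank_eq (LinearMap.range_comp_le_range f f) ?_
      have h1 := LinearMap.finrank_range_add_finrank_ker (f * f)
      have h2 := LinearMap.finrank_range_add_finrank_ker f
      rw [hker] at h1
      omega
    obtain ⟨q, hq⟩ : f ⟨_, hu⟩ ∈ LinearMap.range (f * f) := hrange ▸ LinearMap.mem_range_self f _
    replace hq : T i (T i q) = T i (T i (m - p)) := congrArg Subtype.val hq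
    have hqQ := (hQ q).mp q.2
    refine ⟨p + q, add_mem hp hqQ.1, fun j hj ↦ ?_⟩
    rw [← sub_sub]
    obtain rfl | hj := Finset.mem_insert.mp hj
    · exact (hT j).apply_eq_zero_of_apply_apply_eq_zero
        (by rw [map_sub, map_sub, hq, sub_self])
    · rw [map_sub, h j hj, hqQ.2 j hj, sub_zero]

lemma LieModule.isSemisimple_toEnd_end {K L V : Type*} [Field K] [PerfectField K] [LieRing L]
    [LieAlgebra K L] [AddCommGroup V] [Module K V] [LieRingModule L V] [LieModule K L V]
    [FiniteDimensional K V] {x : L} (hx : (toEnd K L V x).IsSemisimple) :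
    (toEnd K L (V →ₗ[K] V) x).IsSemisimple :=
  LieAlgebra.ad_isSemisimple_of_isSemisimple hx

/-- If the radical is abelian, some linear projection onto it is `g`-invariant modulo the inner
derivations by elements of the radical. -/
theorem LieAlgebra.exists_projection_radical_lie_mem {K g : Type*} [Field K] [CharZero K]
    [LieRing g] [LieAlgebra K g] [FiniteDimensional K g]
    (hrr : ∀ x ∈ radical K g, ∀ y ∈ radical K g, ⁅x, y⁆ = 0) :
    ∃ φ : g →ₗ[K] g, (∀ x, φ x ∈ radical K g) ∧ (∀ x ∈ radical K g, φ x = x) ∧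
      ∀ x : g, ∃ u ∈ radical K g, ⁅x, φ⁆ = toEnd K g g u := by
  let V : LieSubmodule K g (g →ₗ[K] g) :=
    { carrier := {φ | (∀ x, φ x ∈ radical K g) ∧ ∃ c : K, ∀ z ∈ radical K g, φ z = c • z}
      add_mem' := by
        rintro φ ψ ⟨hφ, c, hc⟩ ⟨hψ, d, hd⟩
        exact ⟨fun x ↦ add_mem (hφ x) (hψ x), c + d, fun z hz ↦ by
          rw [LinearMap.add_apply, hc z hz, hd z hz, add_smul]⟩
      zero_mem' := ⟨fun x ↦ zero_mem _, 0, fun z hz ↦ by simp⟩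
      smul_mem' := by
        rintro t φ ⟨hφ, c, hc⟩
        exact ⟨fun x ↦ (radical K g).smul_mem t (hφ x), t * c, fun z hz ↦ by
          rw [LinearMap.smul_apply, hc z hz, mul_smul]⟩
      lie_mem := by
        rintro x φ ⟨hφ, c, hc⟩
        refine ⟨fun y ↦ ?_, 0, fun z hz ↦ ?_⟩
        · rw [LieHom.lie_apply]
          exact sub_mem ((radical K g).lie_mem (hφ y)) (hφ _)
        · rw [LieHom.lie_apply, hc z hz, hc _ ((radical K g).lie_mem hz), lie_smul, sub_self,
            zero_smul] }
  let W : LieSubmodule K g V :=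
    { carrier := {φ | ∀ z ∈ radical K g, φ.1 z = 0}
      add_mem' := fun {φ ψ} hφ hψ z hz ↦ by
        change φ.1 z + ψ.1 z = 0
        rw [hφ z hz, hψ z hz, add_zero]
      zero_mem' := fun z hz ↦ rfl
      smul_mem' := fun t φ hφ z hz ↦ by
        change t • φ.1 z = 0
        rw [hφ z hz, smul_zero]
      lie_mem := fun {x φ} hφ z hz ↦ by
        change ⁅x, φ.1⁆ z = 0
        rw [LieHom.lie_apply, hφ z hz, hφ _ ((radical K g).lie_mem hz), lie_zero, sub_zero] }
  let P : LieSubmodule K g V :=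
    { carrier := {φ | ∃ u ∈ radical K g, φ.1 = toEnd K g g u}
      add_mem' := by
        rintro φ ψ ⟨u, hu, h⟩ ⟨v, hv, h'⟩
        exact ⟨u + v, add_mem hu hv, by rw [map_add, ← h, ← h']; rfl⟩
      zero_mem' := ⟨0, zero_mem _, by rw [map_zero]; rfl⟩
      smul_mem' := by
        rintro t φ ⟨u, hu, h⟩
        exact ⟨t • u, (radical K g).smul_mem t hu, by rw [map_smul, ← h]; rfl⟩
      lie_mem := by
        rintro x φ ⟨u, hu, h⟩
        refine ⟨⁅x, u⁆, (radical K g).lie_mem hu, LinearMap.ext fun y ↦ ?_⟩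
        change ⁅x, φ.1⁆ y = _
        rw [h]
        simp }
  have hPW : P ≤ W := by
    rintro φ ⟨u, hu, h⟩ z hz
    rw [h]
    exact hrr u hu z hz
  have hV (x : g) (φ : V) : ⁅x, φ⁆ ∈ W := fun z hz ↦ by
    obtain ⟨-, c, hc⟩ := φ.2
    change ⁅x, φ.1⁆ z = 0
    rw [LieHom.lie_apply, hc z hz, hc _ ((radical K g).lie_mem hz), lie_smul, sub_self]
  have hker (x) (hx : x ∈ (radical K g).mkHom.ker) (q : V ⧸ P) : ⁅x, q⁆ = 0 := by
    obtain ⟨φ, rfl⟩ := LieSubmodule.Quotient.surjective_mk' P q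
    rw [LieHom.mem_ker, LieIdeal.mkHom_eq_zero] at hx
    rw [← LieModuleHom.map_lie]
    refine (LieSubmodule.Quotient.mk_eq_zero P).mpr ?_
    obtain ⟨hφ, c, hc⟩ := φ.2
    refine ⟨-(c • x), neg_mem ((radical K g).smul_mem c hx), LinearMap.ext fun y ↦ ?_⟩
    change ⁅x, φ.1⁆ y = _
    rw [LieHom.lie_apply, hrr x hx _ (hφ y), hc _ (lie_mem_left K g _ x y hx), toEnd_apply_apply,
      neg_lie, smul_lie, zero_sub]
  obtain ⟨f, hf⟩ := (radical K g).toSubmodule.subtype.exists_leftInverse_of_injective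
    (Submodule.ker_subtype _)
  let φ₀ : V := ⟨(radical K g).toSubmodule.subtype ∘ₗ f, fun x ↦ (f x).2, 1, fun z hz ↦ by
    rw [one_smul]
    exact congrArg Subtype.val (LinearMap.congr_fun hf ⟨z, hz⟩)⟩
  obtain ⟨q, hq, h⟩ := exists_mem_forall_lie_sub_eq_zero_of_surjective (radical K g).mkHom
    (radical K g).mkHom_surjective hker (W.map (LieSubmodule.Quotient.mk' P))
    (LieSubmodule.Quotient.mk' P φ₀)
    (fun x ↦ by
      rw [← LieModuleHom.map_lie]
      exact LieSubmodule.mem_map_of_mem (hV x φ₀))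
  obtain ⟨w, hw, rfl⟩ := (LieSubmodule.mem_map _).mp hq
  refine ⟨(φ₀ - w).1, (φ₀ - w).2.1, fun z hz ↦ ?_, fun x ↦ ?_⟩
  · change f z - w.1 z = z
    rw [hw z hz, sub_zero]
    exact congrArg Subtype.val (LinearMap.congr_fun hf ⟨z, hz⟩)
  · have := h x
    rw [← map_sub, ← LieModuleHom.map_lie] at this
    exact (LieSubmodule.Quotient.mk_eq_zero P).mp this

/-- If the radical is abelian, the projection of `LieAlgebra.exists_projection_radical_lie_mem` can
be chosen to commute with a given abelian subalgebra of semisimple elements. -/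
theorem LieAlgebra.exists_projection_radical_lie_eq_zero {K g : Type*} [Field K] [CharZero K]
    [LieRing g] [LieAlgebra K g] [FiniteDimensional K g]
    (hrr : ∀ x ∈ radical K g, ∀ y ∈ radical K g, ⁅x, y⁆ = 0)
    (a : LieSubalgebra K g) (hab : IsLieAbelian a)
    (hss : ∀ H ∈ a, Module.End.IsSemisimple (ad K g H)) :
    ∃ φ : g →ₗ[K] g, (∀ x, φ x ∈ radical K g) ∧ (∀ x ∈ radical K g, φ x = x) ∧
      (∀ x : g, ∃ u ∈ radical K g, ⁅x, φ⁆ = toEnd K g g u) ∧ ∀ H ∈ a, ⁅H, φ⁆ = 0 := by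
  obtain ⟨φ, hφ, hφr, hφg⟩ := exists_projection_radical_lie_mem hrr
  obtain ⟨s, hs⟩ := Module.Finite.fg_top (R := K) (M := a)
  obtain ⟨p, ⟨u, hu, rfl⟩, h⟩ := End.exists_mem_forall_apply_sub_eq_zero
    (fun H : a ↦ toEnd K g (g →ₗ[K] g) H) (fun H ↦ isSemisimple_toEnd_end (hss H H.2))
    (fun H H' ↦ LinearMap.ext fun ψ ↦ by
      have hHH' : ⁅(H : g), (H' : g)⁆ = 0 := congrArg Subtype.val (trivial_lie_zero a a H H')
      change ⁅(H : g), ⁅(H' : g), ψ⁆⁆ = ⁅(H' : g), ⁅(H : g), ψ⁆⁆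
      rw [leibniz_lie, hHH', zero_lie, zero_add])
    ((radical K g).toSubmodule.map (toEnd K g g : g →ₗ[K] End K g))
    (by
      rintro H - ⟨u, hu, rfl⟩
      refine ⟨⁅(H : g), u⁆, (radical K g).lie_mem hu, LinearMap.ext fun y ↦ ?_⟩
      simp)
    (m := φ) (fun H ↦ by
      obtain ⟨u, hu, h⟩ := hφg H
      exact ⟨u, hu, h.symm⟩) s
  refine ⟨φ - toEnd K g g u, fun x ↦ sub_mem (hφ x) (lie_mem_left K g _ u x hu), fun x hx ↦ ?_,
    fun x ↦ ?_, fun H hH ↦ ?_⟩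
  · rw [LinearMap.sub_apply, hφr x hx, toEnd_apply_apply, hrr u hu x hx, sub_zero]
  · obtain ⟨v, hv, h⟩ := hφg x
    refine ⟨v - ⁅x, u⁆, sub_mem hv ((radical K g).lie_mem hu), ?_⟩
    rw [lie_sub, h, map_sub]
    congr 1
    ext y
    simp
  · obtain ⟨H, rfl⟩ : ∃ H' : a, H = H' := ⟨⟨H, hH⟩, rfl⟩
    have hHs : H ∈ Submodule.span K (s : Set a) := hs ▸ Submodule.mem_top
    clear hH
    induction hHs using Submodule.span_induction with
    | mem x hx => exact h x hx
    | zero => exact zero_lie _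
    | add x y _ _ hx hy => exact (add_lie _ _ _).trans (by rw [hx, hy, add_zero])
    | smul t x _ hx => exact (smul_lie _ _ _).trans (by rw [hx, smul_zero])

theorem LieAlgebra.exists_isSemisimple_isCompl_radical_ge {K g : Type*} [Field K] [CharZero K]
    [LieRing g] [LieAlgebra K g] [FiniteDimensional K g]
    (hrr : ∀ x ∈ radical K g, ∀ y ∈ radical K g, ⁅x, y⁆ = 0) (hcenter : center K g = ⊥)
    (a : LieSubalgebra K g) (hab : IsLieAbelian a)
    (hss : ∀ H ∈ a, Module.End.IsSemisimple (ad K g H)) :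
    ∃ l : LieSubalgebra K g, (IsSemisimple K l ∧
      IsCompl l.toSubmodule (radical K g).toSubmodule) ∧ a ≤ l := by
  obtain ⟨φ, hφ, hφr, hφg, ha⟩ := exists_projection_radical_lie_eq_zero hrr a hab hss
  let l : LieSubalgebra K g :=
    { carrier := {x | ⁅x, φ⁆ = 0}
      add_mem' := fun {x y} hx hy ↦ by
        change ⁅x + y, φ⁆ = 0
        rw [add_lie, hx, hy, add_zero]
      zero_mem' := zero_lie φ
      smul_mem' := fun t x hx ↦ by
        change ⁅t • x, φ⁆ = 0
        rw [smul_lie, hx, smul_zero]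
      lie_mem' := fun {x y} hx hy ↦ by
        change ⁅⁅x, y⁆, φ⁆ = 0
        rw [lie_lie, hx, hy, lie_zero, lie_zero, sub_zero] }
  have hl (x : g) : x ∈ l ↔ ⁅x, φ⁆ = 0 := Iff.rfl
  have hr (u : g) (hu : u ∈ radical K g) : ⁅u, φ⁆ = -toEnd K g g u := LinearMap.ext fun y ↦ by
    rw [LieHom.lie_apply, hrr u hu _ (hφ y), hφr _ (lie_mem_left K g _ u y hu), zero_sub]
    rfl
  have hdisj (x : g) (hx : x ∈ l) (hxr : x ∈ radical K g) : x = 0 := by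
    rw [hl, hr x hxr, neg_eq_zero] at hx
    have hc : x ∈ center K g := fun y ↦ by
      rw [← lie_skew, neg_eq_zero]
      exact LinearMap.congr_fun hx y
    simpa [hcenter] using hc
  have hcodisj (x : g) : ∃ u ∈ radical K g, x + u ∈ l := by
    obtain ⟨u, hu, h⟩ := hφg x
    exact ⟨u, hu, by rw [hl, add_lie, h, hr u hu, add_neg_cancel]⟩
  refine ⟨l, ⟨?_, ?_⟩, ha⟩
  · have e : l ≃ₗ⁅K⁆ g ⧸ radical K g := LieEquiv.ofBijective ((radical K g).mkHom.comp l.incl)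
      ⟨(injective_iff_map_eq_zero _).mpr fun x hx ↦
        Subtype.ext (hdisj x x.2 (LieIdeal.mkHom_eq_zero.mp hx)), fun q ↦ by
        obtain ⟨x, rfl⟩ := (radical K g).mkHom_surjective q
        obtain ⟨u, hu, hxu⟩ := hcodisj x
        refine ⟨⟨x + u, hxu⟩, ?_⟩
        change (radical K g).mkHom (x + u) = _
        rw [map_add, LieIdeal.mkHom_eq_zero.mpr hu, add_zero]⟩
    have := LieAlgebra.isKilling_of_equiv e.symm
    infer_instance
  · refine ⟨Submodule.disjoint_def.mpr hdisj, codisjoint_iff.mpr (eq_top_iff.mpr fun x _ ↦ ?_)⟩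
    obtain ⟨u, hu, hxu⟩ := hcodisj x
    exact Submodule.mem_sup.mpr ⟨x + u, hxu, -u, neg_mem hu, by abel⟩

end

/-- Suppose `⁅g, r⁆ = r`, `⁅r, r⁆ = 0` and the centre of `g` is trivial. If `a` is an abelian
subalgebra such that `ad H` is semisimple for every `H ∈ a`, then some Levi subalgebra of `g`
contains `a`. -/
theorem exists_levi_containing_abelian_semisimple_subalgebra
    (g : Type*) [LieRing g] [LieAlgebra ℝ g] [FiniteDimensional ℝ g]
    (hgr : (⁅(⊤ : LieIdeal ℝ g), LieAlgebra.radical ℝ g⁆ : LieIdeal ℝ g)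
      = LieAlgebra.radical ℝ g)
    (hrr : ∀ x ∈ LieAlgebra.radical ℝ g, ∀ y ∈ LieAlgebra.radical ℝ g, ⁅x, y⁆ = 0)
    (hcenter : LieAlgebra.center ℝ g = ⊥)
    (a : LieSubalgebra ℝ g) (hab : IsLieAbelian a)
    (hss : ∀ H ∈ a, Module.End.IsSemisimple (LieAlgebra.ad ℝ g H)) :
    ∃ l : LieSubalgebra ℝ g, IsLeviSubalgebra g l ∧ a ≤ l := by
  exact LieAlgebra.exists_isSemisimple_isCompl_radical_ge hrr hcenter a hab hss
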